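/- arXiv:1304.5720 — 6 statements merged into one kernel-verified Lean document; each statement's English description precedes it below -/
import Mathlib

section
/- Let K be a field, let n ≥ 1, and consider a quiver Q of type A_n, i.e. vertices 1,…,n with, for each i ∈ {1,…,n−1}, one arrow between i and i+1 whose direction is given by an arbitrary orientation. Then every representation of Q by K-vector spaces (not necessarily finite-dimensional) is a direct sum of thin representations. Concretely: given K-vector spaces V_1,…,V_n, an orientation ε : {1,…,n−1} → {+,−}, and linear maps f_i : V_i → V_{i+1} when ε(i)=+ and f_i : V_{i+1} → V_i when ε(i)=−, there exist bases B_i of V_i (for each i) such that every map f_i sends each element of its source basis either to 0 or to an element of the target basis, and f_i is injective on the set of source basis elements not mapped to 0. -/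
/-- A linearly independent set whose intersection with each subspace in `S` spans that subspace. -/
def IsAdaptedTo {K V : Type*} [Field K] [AddCommGroup V] [Module K V]
    (S : Set (Submodule K V)) (B : Set V) : Prop :=
  LinearIndepOn K id B ∧ ∀ P ∈ S, P ≤ Submodule.span K (B ∩ P)

/-- `φ` maps each element of `B` to `0` or to an element of `C`, injectively on the elements of
`B` outside the kernel. -/
def IsPartialMatching {K V W : Type*} [Field K] [AddCommGroup V] [Module K V]
    [AddCommGroup W] [Module K W] (φ : V →ₗ[K] W) (B : Set V) (C : Set W) : Prop :=
  (∀ b ∈ B, φ b = 0 ∨ φ b ∈ C) ∧ Set.InjOn φ {b ∈ B | φ b ≠ 0}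

section

variable {K V W : Type*} [Field K] [AddCommGroup V] [Module K V] [AddCommGroup W] [Module K W]

/-- A vector of `U` outside `span E`, as deep as possible in the finite chain `S`, can be added
to `E` while keeping `E` compatible with `S`. -/
theorem exists_insert_compatible {S : Set (Submodule K V)} (hfin : S.Finite)
    (hchain : IsChain (· ≤ ·) S) {U : Submodule K V} {E : Set V} (hEU : E ⊆ U)
    (hE : ∀ P ∈ S, Submodule.span K E ⊓ P ≤ Submodule.span K (E ∩ P))
    (hU : ¬ U ≤ Submodule.span K E) :
    ∃ v ∈ U, v ∉ Submodule.span K E ∧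
      ∀ P ∈ S, Submodule.span K (insert v E) ⊓ P ≤ Submodule.span K (insert v E ∩ P) := by
  obtain ⟨v, hvU, hvE, hv⟩ : ∃ v ∈ U, v ∉ Submodule.span K E ∧
      ∀ P ∈ S, v ∈ P ∨ U ⊓ P ≤ Submodule.span K E := by
    let T := {P ∈ S | ¬ U ⊓ P ≤ Submodule.span K E}
    rcases T.eq_empty_or_nonempty with hT | hT
    · obtain ⟨v, hvU, hvE⟩ := SetLike.not_le_iff_exists.mp hU
      refine ⟨v, hvU, hvE, fun P hP => Or.inr ?_⟩
      by_contra h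
      exact Set.notMem_empty P (hT ▸ (⟨hP, h⟩ : P ∈ T))
    · obtain ⟨P, hP⟩ := (hfin.subset (Set.sep_subset _ _) : T.Finite).exists_minimal hT
      obtain ⟨v, hv, hvE⟩ := SetLike.not_le_iff_exists.mp hP.prop.2
      refine ⟨v, hv.1, hvE, fun Q hQ => ?_⟩
      by_contra! h
      rcases hchain.total hP.prop.1 hQ with hPQ | hQP
      · exact h.1 (hPQ hv.2)
      · exact h.1 (hP.le_of_le ⟨hQ, h.2⟩ hQP hv.2)
  refine ⟨v, hvU, hvE, fun P hP x hx => ?_⟩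
  obtain ⟨hx, hxP⟩ := hx
  have hmono : Submodule.span K (E ∩ P) ≤ Submodule.span K (insert v E ∩ P) :=
    Submodule.span_mono (Set.inter_subset_inter_left _ (Set.subset_insert _ _))
  rcases hv P hP with hvP | hle
  · obtain ⟨a, e, he, rfl⟩ := Submodule.mem_span_insert.mp hx
    have heP : e ∈ P := (P.add_mem_iff_right (P.smul_mem a hvP)).mp hxP
    exact add_mem (Submodule.smul_mem _ _ (Submodule.subset_span ⟨Set.mem_insert _ _, hvP⟩))
      (hmono (hE P hP ⟨he, heP⟩))
  · have hxU : x ∈ U :=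
      Submodule.span_le.mpr (Set.insert_subset hvU hEU) hx
    exact hmono (hE P hP ⟨hle ⟨hxU, hxP⟩, hxP⟩)

/-- A linearly independent subset `D` of `U` that is compatible with the finite chain `S` extends
to a basis of `U` compatible with `S`. -/
theorem exists_adapted_extension {S : Set (Submodule K V)} (hfin : S.Finite)
    (hchain : IsChain (· ≤ ·) S) {U : Submodule K V} {D : Set V} (hDU : D ⊆ U)
    (hD : LinearIndepOn K id D)
    (hDS : ∀ P ∈ S, Submodule.span K D ⊓ P ≤ Submodule.span K (D ∩ P)) :
    ∃ B : Set V, D ⊆ B ∧ B ⊆ U ∧ LinearIndepOn K id B ∧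
      ∀ P ∈ S, U ⊓ P ≤ Submodule.span K (B ∩ P) := by
  let F : Set (Set V) := {E | E ⊆ U ∧ LinearIndepOn K id E ∧
    ∀ P ∈ S, Submodule.span K E ⊓ P ≤ Submodule.span K (E ∩ P)}
  obtain ⟨B, hDB, hB⟩ := zorn_subset_nonempty F (fun c hcF hc hne => by
    refine ⟨⋃₀ c, ⟨Set.sUnion_subset fun s hs => (hcF hs).1,
      linearIndepOn_sUnion_of_directed hc.directedOn fun s hs => (hcF hs).2.1,
      fun P hP x hx => ?_⟩, fun s hs => Set.subset_sUnion_of_mem hs⟩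
    obtain ⟨hx, hxP⟩ := hx
    obtain ⟨t, htc, hxt⟩ := Submodule.mem_span_finite_of_mem_span hx
    obtain ⟨s, hs, hts⟩ :=
      hc.directedOn.exists_mem_subset_of_finite_of_subset_sUnion hne t.finite_toSet htc
    exact Submodule.span_mono (Set.inter_subset_inter_left _ (Set.subset_sUnion_of_mem hs))
      ((hcF hs).2.2 P hP ⟨Submodule.span_mono hts hxt, hxP⟩)) D ⟨hDU, hD, hDS⟩
  obtain ⟨hBU, hBi, hBS⟩ := hB.prop
  refine ⟨B, hDB, hBU, hBi, fun P hP => ?_⟩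
  have hUB : U ≤ Submodule.span K B := by
    by_contra hU
    obtain ⟨v, hvU, hvB, hv⟩ := exists_insert_compatible hfin hchain hBU hBS hU
    exact hvB (Submodule.subset_span (hB.le_of_ge
      (⟨Set.insert_subset hvU hBU, hBi.id_insert hvB, hv⟩ : insert v B ∈ F)
      (Set.subset_insert _ _) (Set.mem_insert _ _)))
  exact (inf_le_inf_right P hUB).trans (hBS P hP)

/-- A basis of the target adapted to the images of a finite chain `S` lifts to a basis of the
source adapted to `S`. -/
theorem exists_adapted_lift {S : Set (Submodule K V)} (hfin : S.Finite)
    (hchain : IsChain (· ≤ ·) S) (φ : V →ₗ[K] W) {C : Set W}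
    (hC : IsAdaptedTo (insert ⊤ (Submodule.map φ '' S)) C) :
    ∃ B : Set V, IsAdaptedTo S B ∧ IsPartialMatching φ B C := by
  have hlift : ∀ c ∈ LinearMap.range φ, ∃ v, φ v = c ∧ ∀ P ∈ S, c ∈ P.map φ → v ∈ P := by
    rintro _ ⟨v, rfl⟩
    let T := {P ∈ S | φ v ∈ P.map φ}
    rcases T.eq_empty_or_nonempty with hT | hT
    · exact ⟨v, rfl, fun P hP h => (Set.notMem_empty P (hT ▸ (⟨hP, h⟩ : P ∈ T))).elim⟩
    · obtain ⟨P, hP⟩ := (hfin.subset (Set.sep_subset _ _) : T.Finite).exists_minimal hT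
      obtain ⟨w, hwP, hw⟩ := hP.prop.2
      refine ⟨w, hw, fun Q hQ h => ?_⟩
      rcases hchain.total hP.prop.1 hQ with hPQ | hQP
      · exact hPQ hwP
      · exact hP.le_of_le ⟨hQ, h⟩ hQP hwP
  choose! s hs hsS using hlift
  let v : ↥(C ∩ LinearMap.range φ) → V := fun c => s c
  have hφv : φ ∘ v = Subtype.val := funext fun c => hs c c.2.2
  have hli : LinearIndependent K (φ ∘ v) := by
    rw [hφv]
    exact hC.1.mono Set.inter_subset_left
  obtain ⟨N, -, hNker, hN, hNS⟩ := exists_adapted_extension hfin hchain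
    (Set.empty_subset (LinearMap.ker φ : Set V)) (linearIndepOn_empty K id) (by simp)
  have hNφ : ∀ b ∈ N, φ b = 0 := fun b hb => hNker hb
  have hdisj : Disjoint (Submodule.span K (Set.range v)) (Submodule.span K N) :=
    (Submodule.range_ker_disjoint hli).mono_right (Submodule.span_le.mpr hNker)
  refine ⟨Set.range v ∪ N, ⟨hli.of_comp.linearIndepOn_id.id_union hN hdisj, fun P hP x hx => ?_⟩,
    ?_, ?_⟩
  · have hsub : C ∩ (P.map φ : Submodule K W) ⊆ φ '' (Set.range v ∩ P) := by
      rintro c ⟨hcC, hcP⟩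
      have hc : c ∈ LinearMap.range φ := LinearMap.map_le_range hcP
      exact ⟨s c, ⟨⟨⟨c, hcC, hc⟩, rfl⟩, hsS c hc P hP hcP⟩, hs c hc⟩
    have hx' := Submodule.span_mono hsub
      (hC.2 _ (Set.mem_insert_of_mem _ ⟨P, hP, rfl⟩) (Submodule.mem_map_of_mem hx))
    rw [Submodule.span_image] at hx'
    obtain ⟨y, hy, hyx⟩ := hx'
    have hyP : y ∈ P := Submodule.span_le.mpr Set.inter_subset_right hy
    have hxy : x - y ∈ Submodule.span K (N ∩ P) :=
      hNS P hP ⟨by simp [hyx], P.sub_mem hx hyP⟩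
    rw [← sub_add_cancel x y]
    exact add_mem
      (Submodule.span_mono (Set.inter_subset_inter_left _ Set.subset_union_right) hxy)
      (Submodule.span_mono (Set.inter_subset_inter_left _ Set.subset_union_left) hy)
  · rintro _ (⟨c, rfl⟩ | hb)
    · exact Or.inr (by rw [show φ (v c) = c from congrFun hφv c]; exact c.2.1)
    · exact Or.inl (hNφ _ hb)
  · rintro _ ⟨⟨c, rfl⟩ | hb, hb0⟩ _ ⟨⟨d, rfl⟩ | hd, hd0⟩ h
    · rw [show c = d from Subtype.ext ((congrFun hφv c).symm.trans (h.trans (congrFun hφv d)))]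
    · exact (hd0 (hNφ _ hd)).elim
    · exact (hb0 (hNφ _ hb)).elim
    · exact (hb0 (hNφ _ hb)).elim

/-- A basis of the source adapted to the kernel and the preimages of a finite chain `S` is
matched with a basis of the target adapted to `S`. -/
theorem exists_adapted_pushforward {S : Set (Submodule K W)} (hfin : S.Finite)
    (hchain : IsChain (· ≤ ·) S) (φ : V →ₗ[K] W) {C : Set V}
    (hC : IsAdaptedTo (insert (LinearMap.ker φ) (Submodule.comap φ '' S)) C) :
    ∃ B : Set W, IsAdaptedTo S B ∧ IsPartialMatching φ C B := by
  let E := {c ∈ C | φ c ≠ 0}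
  have hdisj : Disjoint (Submodule.span K E) (LinearMap.ker φ) := by
    have hEker : Disjoint E (C ∩ LinearMap.ker φ) :=
      Set.disjoint_left.mpr fun c hc hc' => hc.2 hc'.2
    exact ((linearIndepOn_id_union_iff hEker).mp (hC.1.mono
      (Set.union_subset (Set.sep_subset _ _) Set.inter_subset_left))).2.2.mono_right
      (hC.2 _ (Set.mem_insert _ _))
  have hinj : Set.InjOn φ (Submodule.span K E) := LinearMap.injOn_of_disjoint_ker le_rfl hdisj
  have hD : LinearIndepOn K id (φ '' E) := (hC.1.mono (Set.sep_subset _ _)).image hdisj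
  obtain ⟨B, hEB, -, hB, hBS⟩ := exists_adapted_extension hfin hchain
    (U := ⊤) (Set.subset_univ _) hD (fun P hP => by
      rintro _ ⟨hx, hxP⟩
      rw [Submodule.span_image] at hx
      obtain ⟨x, -, rfl⟩ := hx
      have hx := Submodule.mem_map_of_mem (f := φ)
        (hC.2 _ (Set.mem_insert_of_mem _ ⟨P, hP, rfl⟩) (Submodule.mem_comap.mpr hxP))
      rw [← Submodule.span_image] at hx
      refine Submodule.span_le.mpr ?_ hx
      rintro _ ⟨c, ⟨hcC, hcP⟩, rfl⟩
      by_cases hc : φ c = 0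
      · simp [hc]
      · exact Submodule.subset_span ⟨⟨c, ⟨hcC, hc⟩, rfl⟩, hcP⟩)
  refine ⟨B, ⟨hB, fun P hP => by simpa using hBS P hP⟩, fun c hc => ?_,
    hinj.mono Submodule.subset_span⟩
  exact or_iff_not_imp_left.mpr fun h => hEB ⟨c, ⟨hc, h⟩, rfl⟩

end

/-- There is a finite chain of subspaces of the first vertex space such that every basis adapted
to it extends to a family of bases matched by all the arrows. -/
theorem exists_chain_forall_adapted_extends (K : Type*) [Field K] (n : ℕ)
    (V : Fin (n + 1) → Type*) [∀ i, AddCommGroup (V i)] [∀ i, Module K (V i)]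
    (ε : Fin n → Bool)
    (f : ∀ i : Fin n, ε i = true → (V i.castSucc →ₗ[K] V i.succ))
    (g : ∀ i : Fin n, ε i = false → (V i.succ →ₗ[K] V i.castSucc)) :
    ∃ S : Set (Submodule K (V 0)), S.Finite ∧ IsChain (· ≤ ·) S ∧ ⊤ ∈ S ∧
      ∀ C : Set (V 0), IsAdaptedTo S C → ∃ B : ∀ i, Set (V i), B 0 = C ∧
        (∀ i, IsAdaptedTo {(⊤ : Submodule K (V i))} (B i)) ∧
        (∀ i h, IsPartialMatching (f i h) (B i.castSucc) (B i.succ)) ∧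
        (∀ i h, IsPartialMatching (g i h) (B i.succ) (B i.castSucc)) := by
  induction n with
  | zero =>
    refine ⟨{⊤}, Set.finite_singleton _, Set.subsingleton_singleton.isChain, rfl, fun C hC => ?_⟩
    exact ⟨Fin.cases C fun i => i.elim0, rfl, Fin.cases hC fun i => i.elim0, fun i => i.elim0,
      fun i => i.elim0⟩
  | succ n ih =>
    obtain ⟨S, hfin, hchain, htop, hS⟩ := ih (fun i => V i.succ) (fun i => ε i.succ)
      (fun i h => f i.succ h) (fun i h => g i.succ h)
    suffices h : ∃ T : Set (Submodule K (V 0)), T.Finite ∧ IsChain (· ≤ ·) T ∧ ⊤ ∈ T ∧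
        ∀ C : Set (V 0), IsAdaptedTo T C → ∃ B : Set (V 1), IsAdaptedTo S B ∧
          (∀ h, IsPartialMatching (f 0 h) C B) ∧ (∀ h, IsPartialMatching (g 0 h) B C) by
      obtain ⟨T, hTfin, hTchain, hTtop, hT⟩ := h
      refine ⟨T, hTfin, hTchain, hTtop, fun C hC => ?_⟩
      obtain ⟨B₁, hB₁, hf, hg⟩ := hT C hC
      obtain ⟨B, rfl, hB, hBf, hBg⟩ := hS B₁ hB₁
      refine ⟨Fin.cases C B, rfl, Fin.cases ⟨hC.1, ?_⟩ hB, Fin.cases hf hBf, Fin.cases hg hBg⟩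
      rintro _ rfl
      exact hC.2 _ hTtop
    rcases Bool.eq_false_or_eq_true (ε 0) with hε | hε
    · refine ⟨insert (LinearMap.ker (f 0 hε)) (Submodule.comap (f 0 hε) '' S),
        (hfin.image _).insert _,
        (hchain.image_of_map_rel _ _ _ fun _ _ h => Submodule.comap_mono h).insert ?_,
        Set.mem_insert_of_mem _ ⟨⊤, htop, rfl⟩, fun C hC => ?_⟩
      · rintro _ ⟨P, -, rfl⟩ -
        exact Or.inl (LinearMap.ker_le_comap _)
      · obtain ⟨B, hB, hCB⟩ := exists_adapted_pushforward hfin hchain (f 0 hε) hC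
        exact ⟨B, hB, fun _ => hCB, fun h => by simp [hε] at h⟩
    · refine ⟨insert ⊤ (Submodule.map (g 0 hε) '' S), (hfin.image _).insert _,
        (hchain.image_of_map_rel _ _ _ fun _ _ h => Submodule.map_mono h).insert
          fun _ _ _ => Or.inr le_top, Set.mem_insert _ _, fun C hC => ?_⟩
      obtain ⟨B, hB, hBC⟩ := exists_adapted_lift hfin hchain (g 0 hε) hC
      exact ⟨B, hB, fun h => by simp [hε] at h, fun _ => hBC⟩

/-- Every representation (by arbitrary `K`-vector spaces) of a quiver of type `A_n`
(`n ≥ 1`, here with `n + 1` vertices indexed by `Fin (n+1)` so that the case of a single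
vertex corresponds to `n = 0`), with an arbitrary orientation `ε` of the `n` edges,
is a direct sum of thin representations: there are bases `B i` of the vertex spaces
such that each arrow map sends every source basis vector either to `0` or to a target
basis vector, injectively on those not sent to `0`. -/
theorem An_rep_direct_sum_of_thin
    (K : Type*) [Field K] (n : ℕ)
    (V : Fin (n + 1) → Type*) [∀ i, AddCommGroup (V i)] [∀ i, Module K (V i)]
    (ε : Fin n → Bool)
    (f : ∀ i : Fin n, ε i = true → (V i.castSucc →ₗ[K] V i.succ))
    (g : ∀ i : Fin n, ε i = false → (V i.succ →ₗ[K] V i.castSucc)) :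
    ∃ B : ∀ i, Set (V i),
      (∀ i, LinearIndependent K ((↑) : B i → V i) ∧ Submodule.span K (B i) = ⊤) ∧
      (∀ (i : Fin n) (h : ε i = true),
        (∀ b ∈ B i.castSucc, f i h b = 0 ∨ f i h b ∈ B i.succ) ∧
        Set.InjOn (f i h) {b ∈ B i.castSucc | f i h b ≠ 0}) ∧
      (∀ (i : Fin n) (h : ε i = false),
        (∀ b ∈ B i.succ, g i h b = 0 ∨ g i h b ∈ B i.castSucc) ∧
        Set.InjOn (g i h) {b ∈ B i.succ | g i h b ≠ 0}) := by
  obtain ⟨S, hfin, hchain, -, hS⟩ := exists_chain_forall_adapted_extends K n V ε f g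
  obtain ⟨C, -, -, hC, hCS⟩ := exists_adapted_extension hfin hchain (U := ⊤)
    (Set.empty_subset _) (linearIndepOn_empty K id) (by simp)
  obtain ⟨B, -, hB, hf, hg⟩ := hS C ⟨hC, fun P hP => by simpa using hCS P hP⟩
  refine ⟨B, fun i => ⟨(hB i).1, ?_⟩, hf, hg⟩
  simpa using (hB i).2 ⊤ rfl
end

section
/- Let K be a field, V a K-vector space, and U₁, U₂ two subspaces of V. Then there exists a basis S of V that is compatible with both subspaces, i.e. S ∩ U₁ is a basis of U₁ and S ∩ U₂ is a basis of U₂. -/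
/-- For any two subspaces `U₁, U₂` of a vector space `V` there is a basis `S` of `V`
compatible with both: `S ∩ U₁` is a basis of `U₁` and `S ∩ U₂` is a basis of `U₂`. -/
theorem exists_basis_compatible_with_two_subspaces
    (K V : Type*) [Field K] [AddCommGroup V] [Module K V]
    (U₁ U₂ : Submodule K V) :
    ∃ S : Set V,
      LinearIndependent K ((↑) : S → V) ∧ Submodule.span K S = ⊤ ∧
      Submodule.span K (S ∩ (U₁ : Set V)) = U₁ ∧
      Submodule.span K (S ∩ (U₂ : Set V)) = U₂ := by
  obtain ⟨a, haU, -, ha, hai⟩ := exists_linearIndepOn_id_extension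
    (linearIndependent_empty K V) (Set.empty_subset ((U₁ ⊓ U₂ : Submodule K V) : Set V))
  obtain ⟨b, hbU, hab, hb, hbi⟩ := exists_linearIndepOn_id_extension hai
    (haU.trans fun _ hx => hx.1 : a ⊆ (U₁ : Set V))
  obtain ⟨c, hcU, hbc, hc, hci⟩ := exists_linearIndepOn_id_extension hbi
    (Set.subset_union_left : b ⊆ b ∪ (U₂ : Set V))
  obtain ⟨S, -, hcS, hS, hSi⟩ := exists_linearIndepOn_id_extension hci (Set.subset_univ c)
  refine ⟨S, hSi, top_le_iff.mp fun x _ => hS (Set.mem_univ x),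
    le_antisymm (Submodule.span_le.mpr Set.inter_subset_right) fun x hx =>
      Submodule.span_mono (Set.subset_inter (hbc.trans hcS) hbU) (hb hx),
    le_antisymm (Submodule.span_le.mpr Set.inter_subset_right) fun x hx => ?_⟩
  have hcb : c ⊆ b ∪ (c ∩ (U₂ : Set V)) := fun y hy =>
    (hcU hy).imp_right fun h => ⟨hy, h⟩
  have hx' := Submodule.span_mono (R := K) hcb (hc (Or.inr hx))
  rw [Submodule.span_union] at hx'
  obtain ⟨y, hy, z, hz, rfl⟩ := Submodule.mem_sup.mp hx'
  have hzU : z ∈ U₂ := Submodule.span_le.mpr Set.inter_subset_right hz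
  have hyU : y ∈ U₁ ⊓ U₂ :=
    ⟨Submodule.span_le.mpr hbU hy, (Submodule.add_mem_iff_left U₂ hzU).mp hx⟩
  have haS : a ⊆ S ∩ (U₂ : Set V) :=
    Set.subset_inter (hab.trans (hbc.trans hcS)) fun _ h => (haU h).2
  exact add_mem (Submodule.span_mono haS (ha hyU))
    (Submodule.span_mono (Set.inter_subset_inter_left _ hcS) hz)
end

section
/- Let K be a field, V a K-vector space, and suppose given two finite filtrations U₁ ⊆ U₂ ⊆ ⋯ ⊆ U_m and U′₁ ⊆ U′₂ ⊆ ⋯ ⊆ U′_{m′} of V by subspaces. Then there exists a basis S of V that is compatible with all of the subspaces U_i and U′_j simultaneously, i.e. for every i, S ∩ U_i is a basis of U_i, and for every j, S ∩ U′_j is a basis of U′_j. -/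
section Filtration

variable {K V : Type*} [Field K] [AddCommGroup V] [Module K V]

/-- A linearly independent subset `S` of `W` that is compatible with the first `n` steps of a
filtration `F` extends to a linearly independent subset of `W` adapted to `W ⊓ F j` for all
`j < n`. -/
theorem exists_extension_compatible_with_filtration
    {F : ℕ → Submodule K V} (hF : Monotone F) {W : Submodule K V} {S : Set V}
    (hS : LinearIndepOn K id S) (hSW : S ⊆ W) (n : ℕ)
    (hSF : ∀ j < n, Submodule.span K S ⊓ F j ≤ Submodule.span K (S ∩ F j)) :
    ∃ T : Set V, S ⊆ T ∧ T ⊆ W ∧ LinearIndepOn K id T ∧ T ⊆ S ∪ F n ∧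
      ∀ j < n, W ⊓ F j ≤ Submodule.span K (T ∩ F j) := by
  induction n with
  | zero => exact ⟨S, subset_rfl, hSW, hS, Set.subset_union_left, by simp⟩
  | succ n ih =>
    obtain ⟨T, hST, hTW, hT, hTS, hTF⟩ := ih fun j hj ↦ hSF j (by omega)
    obtain ⟨B, hBsub, hTB, hspan, hB⟩ :=
      exists_linearIndepOn_id_extension hT
        (Set.subset_union_left : T ⊆ T ∪ ((W ⊓ F n : Submodule K V) : Set V))
    have hBW : B ⊆ W := fun x hx ↦ (hBsub hx).elim (fun h ↦ hTW h) fun h ↦ h.1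
    have hBS : B ⊆ S ∪ F n := fun x hx ↦ (hBsub hx).elim (fun h ↦ hTS h) fun h ↦ Or.inr h.2
    refine ⟨B, hST.trans hTB, hBW, hB,
      hBS.trans (Set.union_subset_union_right _ (hF n.le_succ)), fun j hj ↦ ?_⟩
    rcases Nat.lt_succ_iff_lt_or_eq.mp hj with hj | rfl
    · exact (hTF j hj).trans (Submodule.span_mono (Set.inter_subset_inter_left _ hTB))
    · rintro x ⟨hxW, hxF⟩
      have hx : x ∈ Submodule.span K (S ∪ (B ∩ F j)) :=
        Submodule.span_mono (fun y hy ↦ (hBS hy).imp id fun h ↦ ⟨hy, h⟩)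
          (hspan (Or.inr ⟨hxW, hxF⟩))
      rw [Submodule.span_union, Submodule.mem_sup] at hx
      obtain ⟨s, hs, b, hb, rfl⟩ := hx
      have hbF : b ∈ F j := Submodule.span_le.mpr Set.inter_subset_right hb
      have hsF : s ∈ F j := ((F j).add_mem_iff_left hbF).mp hxF
      exact add_mem (Submodule.span_mono (Set.inter_subset_inter_left _ (hST.trans hTB))
        (hSF j (by omega) ⟨hs, hsF⟩)) hb

/-- For two filtrations `F` and `G`, with `F` exhaustive at step `N`, there is a linearly independent
subset of `G n` compatible with the first `n` steps of `G` and, on its span, with `F`. -/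
theorem exists_linearIndepOn_compatible_with_two_filtrations
    {F G : ℕ → Submodule K V} (hF : Monotone F) (hG : Monotone G) {N : ℕ} (hN : F N = ⊤) (n : ℕ) :
    ∃ T : Set V, LinearIndepOn K id T ∧ T ⊆ G n ∧
      (∀ i < n, G i ≤ Submodule.span K (T ∩ G i)) ∧
      ∀ j ≤ N, Submodule.span K T ⊓ F j ≤ Submodule.span K (T ∩ F j) := by
  induction n with
  | zero => exact ⟨∅, linearIndepOn_empty K id, by simp, by simp, by simp⟩
  | succ n ih =>
    obtain ⟨T, hT, hTG, hGT, hTF⟩ := ih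
    obtain ⟨B, hTB, hBG, hB, -, hBF⟩ := exists_extension_compatible_with_filtration hF hT hTG
      (N + 1) fun j hj ↦ hTF j (by omega)
    refine ⟨B, hB, hBG.trans (hG n.le_succ), fun i hi ↦ ?_, fun j hj ↦ ?_⟩
    · rcases Nat.lt_succ_iff_lt_or_eq.mp hi with hi | rfl
      · exact (hGT i hi).trans (Submodule.span_mono (Set.inter_subset_inter_left _ hTB))
      · simpa [hN, Set.inter_eq_left.mpr hBG] using hBF N (by omega)
    · exact (inf_le_inf_right _ (Submodule.span_le.mpr hBG)).trans (hBF j (by omega))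

/-- Extend a finite chain of subspaces by `⊤`. -/
def extendByTop {m : ℕ} (U : Fin m → Submodule K V) (k : ℕ) : Submodule K V :=
  if h : k < m then U ⟨k, h⟩ else ⊤

theorem extendByTop_val {m : ℕ} (U : Fin m → Submodule K V) (i : Fin m) :
    extendByTop U i = U i := by
  simp [extendByTop]

theorem extendByTop_self {m : ℕ} (U : Fin m → Submodule K V) : extendByTop U m = ⊤ := by
  simp [extendByTop]

theorem extendByTop_monotone {m : ℕ} {U : Fin m → Submodule K V} (hU : Monotone U) :
    Monotone (extendByTop U) := by
  intro a b hab
  by_cases hb : b < m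
  · simpa [extendByTop, hb, hab.trans_lt hb] using hU (Fin.mk_le_mk.mpr hab)
  · simp [extendByTop, hb]

end Filtration

/-- Given two finite filtrations `U₁ ⊆ ⋯ ⊆ U_m` and `U′₁ ⊆ ⋯ ⊆ U′_{m'}` of a vector
space `V`, there is a basis `S` of `V` compatible with all the subspaces `U i`, `U' j`
simultaneously. -/
theorem exists_basis_compatible_with_two_filtrations
    (K V : Type*) [Field K] [AddCommGroup V] [Module K V]
    (m m' : ℕ) (U : Fin m → Submodule K V) (U' : Fin m' → Submodule K V)
    (hU : Monotone U) (hU' : Monotone U') :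
    ∃ S : Set V,
      LinearIndependent K ((↑) : S → V) ∧ Submodule.span K S = ⊤ ∧
      (∀ i, Submodule.span K (S ∩ (U i : Set V)) = U i) ∧
      (∀ j, Submodule.span K (S ∩ (U' j : Set V)) = U' j) := by
  obtain ⟨T, hT, -, hTU, hTU'⟩ := exists_linearIndepOn_compatible_with_two_filtrations
    (extendByTop_monotone hU') (extendByTop_monotone hU) (extendByTop_self U') (m + 1)
  have hspan : Submodule.span K T = ⊤ := by
    simpa [extendByTop_self] using hTU m m.lt_succ_self
  refine ⟨T, hT, hspan, fun i ↦ ?_, fun j ↦ ?_⟩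
  · refine le_antisymm (Submodule.span_le.mpr Set.inter_subset_right) ?_
    simpa only [extendByTop_val] using hTU i (by omega)
  · refine le_antisymm (Submodule.span_le.mpr Set.inter_subset_right) ?_
    simpa only [extendByTop_val, hspan, top_inf_eq] using hTU' j j.isLt.le
end

section
/- Let K be a field and let f : V₁ → V₂ and g : V₃ → V₂ be two injective K-linear maps between K-vector spaces (a representation of the quiver A₃ with orientation 1→2←3 in which the middle vertex is a peak). Then there exist bases B₁ of V₁, B₂ of V₂, and B₃ of V₃ such that f maps B₁ injectively into B₂, g maps B₃ injectively into B₂, and f(B₁) ∩ g(B₃) is a basis of the subspace f(V₁) ∩ g(V₃). In particular the representation (V₁, V₂, V₃; f, g) is a direct sum of thin representations. -/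
/-- Two subspaces admit bases whose union is independent and whose intersection
spans the intersection of the subspaces. -/
theorem Submodule.exists_linearIndepOn_union_span_inter_eq_inf {K V : Type*} [Field K]
    [AddCommGroup V] [Module K V] (P Q : Submodule K V) :
    ∃ C D : Set V, Submodule.span K C = P ∧ Submodule.span K D = Q ∧
      LinearIndepOn K id (C ∪ D) ∧ Submodule.span K (C ∩ D) = P ⊓ Q := by
  obtain ⟨B, hB, -, hBs, hBi⟩ := exists_linearIndepOn_id_extension
    (linearIndepOn_empty K (id : V → V)) (Set.empty_subset ((P ⊓ Q : Submodule K V) : Set V))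
  obtain ⟨C, hC, hBC, hCs, hCi⟩ := exists_linearIndepOn_id_extension hBi
    (hB.trans fun _ h => h.1 : B ⊆ (P : Set V))
  obtain ⟨D, hD, hBD, hDs, hDi⟩ := exists_linearIndepOn_id_extension hBi
    (hB.trans fun _ h => h.2 : B ⊆ (Q : Set V))
  have hCP : Submodule.span K C = P := le_antisymm (Submodule.span_le.2 hC) hCs
  have hDQ : Submodule.span K D = Q := le_antisymm (Submodule.span_le.2 hD) hDs
  refine ⟨C, D, hCP, hDQ, ?_, le_antisymm (le_inf ?_ ?_) ?_⟩
  · have h_union : C ∪ D = C ∪ (D \ B) := by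
      ext x
      have := @hBC x
      simp only [Set.mem_union, Set.mem_sdiff]
      tauto
    have h_disj : Disjoint (Submodule.span K B) (Submodule.span K (D \ B)) := by
      have hBD' : LinearIndepOn K id (B ∪ D \ B) := by rwa [Set.union_sdiff_cancel hBD]
      simpa using ((linearIndepOn_union_iff Set.disjoint_sdiff_right).1 hBD').2.2
    rw [h_union]
    refine hCi.id_union (hDi.mono Set.sdiff_subset) (Submodule.disjoint_def.2 fun x hx hy => ?_)
    refine Submodule.disjoint_def.1 h_disj x (hBs ⟨hCP ▸ hx, ?_⟩) hy
    exact hDQ ▸ Submodule.span_mono Set.sdiff_subset hy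
  · exact hCP ▸ Submodule.span_mono Set.inter_subset_left
  · exact hDQ ▸ Submodule.span_mono Set.inter_subset_right
  · exact fun x hx => Submodule.span_mono (Set.subset_inter hBC hBD) (hBs hx)

/-- The preimage under an injective linear map of a basis of its range is a basis,
and maps onto it. -/
theorem linearIndepOn_preimage_and_span_eq_top {K V W : Type*} [Field K]
    [AddCommGroup V] [Module K V] [AddCommGroup W] [Module K W]
    (f : V →ₗ[K] W) (hf : Function.Injective f) {C : Set W}
    (hC : LinearIndepOn K id C) (hs : Submodule.span K C = LinearMap.range f) :
    f '' (f ⁻¹' C) = C ∧ LinearIndepOn K id (f ⁻¹' C) ∧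
      Submodule.span K (f ⁻¹' C) = ⊤ := by
  have h_image : f '' (f ⁻¹' C) = C := Set.image_preimage_eq_of_subset fun x hx =>
    LinearMap.mem_range.1 (hs ▸ Submodule.subset_span hx)
  refine ⟨h_image, ?_, ?_⟩
  · refine LinearIndepOn.of_comp f ?_
    refine (linearIndepOn_iff_image hf.injOn).2 ?_
    rwa [h_image]
  · apply Submodule.map_injective_of_injective hf
    rw [Submodule.map_span, h_image, hs, Submodule.map_top]

/-- A representation of the quiver `1 → 2 ← 3` with peak `2` (i.e. `f, g` injective)
is a direct sum of thin representations: there are bases `B₁, B₂, B₃` with `f` mapping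
`B₁` injectively into `B₂`, `g` mapping `B₃` injectively into `B₂`, and
`f(B₁) ∩ g(B₃)` a basis of `f(V₁) ∩ g(V₃)`. -/
theorem A3_peak_inj_inj_direct_sum_of_thin
    (K V₁ V₂ V₃ : Type*) [Field K]
    [AddCommGroup V₁] [Module K V₁] [AddCommGroup V₂] [Module K V₂]
    [AddCommGroup V₃] [Module K V₃]
    (f : V₁ →ₗ[K] V₂) (g : V₃ →ₗ[K] V₂)
    (hf : Function.Injective f) (hg : Function.Injective g) :
    ∃ (B₁ : Set V₁) (B₂ : Set V₂) (B₃ : Set V₃),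
      LinearIndependent K ((↑) : B₁ → V₁) ∧ Submodule.span K B₁ = ⊤ ∧
      LinearIndependent K ((↑) : B₂ → V₂) ∧ Submodule.span K B₂ = ⊤ ∧
      LinearIndependent K ((↑) : B₃ → V₃) ∧ Submodule.span K B₃ = ⊤ ∧
      (f '' B₁ ⊆ B₂) ∧ Set.InjOn f B₁ ∧
      (g '' B₃ ⊆ B₂) ∧ Set.InjOn g B₃ ∧
      Submodule.span K (f '' B₁ ∩ g '' B₃) = LinearMap.range f ⊓ LinearMap.range g := by
  obtain ⟨C, D, hC, hD, hCD, h_inter⟩ :=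
    Submodule.exists_linearIndepOn_union_span_inter_eq_inf (LinearMap.range f) (LinearMap.range g)
  obtain ⟨B, -, hB, hBs, hBi⟩ := exists_linearIndepOn_id_extension hCD (Set.subset_univ _)
  obtain ⟨hf_image, hf_indep, hf_span⟩ := linearIndepOn_preimage_and_span_eq_top f hf
    (hCD.mono Set.subset_union_left) hC
  obtain ⟨hg_image, hg_indep, hg_span⟩ := linearIndepOn_preimage_and_span_eq_top g hg
    (hCD.mono Set.subset_union_right) hD
  refine ⟨f ⁻¹' C, B, g ⁻¹' D, hf_indep, hf_span, hBi, ?_, hg_indep, hg_span,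
    ?_, hf.injOn, ?_, hg.injOn, ?_⟩
  · exact eq_top_iff.2 fun x _ => hBs (Set.mem_univ x)
  · exact hf_image.trans_subset (Set.subset_union_left.trans hB)
  · exact hg_image.trans_subset (Set.subset_union_right.trans hB)
  · rw [hf_image, hg_image, h_inter]
end

section
/- Let K be a field and let f : V₁ → V₂ be an injective K-linear map and g : V₂ → V₃ a surjective K-linear map between K-vector spaces (a representation of the quiver A₃ with orientation 1→2→3 in which the middle vertex is a peak). Then there exist bases B₁ of V₁, B₂ of V₂, and B₃ of V₃ such that: f maps B₁ injectively into B₂; every element of B₂ is sent by g either to 0 or to an element of B₃; g is injective on the set of elements of B₂ not sent to 0; and g maps that set onto B₃. In particular the representation (V₁, V₂, V₃; f, g) is a direct sum of thin representations. -/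
/-- Any two subspaces admit a common adapted basis of the ambient space. -/
theorem exists_linearIndepOn_adapted {K V : Type*} [Field K] [AddCommGroup V] [Module K V]
    (P Q : Submodule K V) :
    ∃ B : Set V, LinearIndepOn K id B ∧ Submodule.span K B = ⊤ ∧
      P ≤ Submodule.span K (B ∩ P) ∧ Q ≤ Submodule.span K (B ∩ Q) := by
  obtain ⟨S, hS, -, hSspan, hSli⟩ := exists_linearIndepOn_id_extension
    (linearIndepOn_empty K id) (Set.empty_subset ((P : Set V) ∩ Q))
  obtain ⟨T, hT, hST, hTspan, hTli⟩ := exists_linearIndepOn_id_extension hSli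
    (hS.trans Set.inter_subset_left)
  obtain ⟨U, hU, hTU, hUspan, hUli⟩ := exists_linearIndepOn_id_extension hTli
    (hT.trans (Set.subset_union_left (t := (Q : Set V))))
  obtain ⟨B, -, hUB, hBspan, hBli⟩ := exists_linearIndepOn_id_extension hUli
    (Set.subset_univ U)
  refine ⟨B, hBli, top_unique fun x _ => hBspan (Set.mem_univ x), fun x hx =>
    Submodule.span_mono (Set.subset_inter (hTU.trans hUB) hT) (hTspan hx), fun x hx => ?_⟩
  have hxU : x ∈ Submodule.span K (U ∩ P) ⊔ Submodule.span K (U ∩ Q) := by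
    rw [← Submodule.span_union, ← Set.inter_union_distrib_left, Set.inter_eq_left.2 hU]
    exact hUspan (Or.inr hx)
  obtain ⟨p, hp, q, hq, rfl⟩ := Submodule.mem_sup.1 hxU
  have hpP : p ∈ P := Submodule.span_le.2 Set.inter_subset_right hp
  have hqQ : q ∈ Q := Submodule.span_le.2 Set.inter_subset_right hq
  have hpQ : p ∈ Q := (Submodule.add_mem_iff_left Q hqQ).1 hx
  exact add_mem
    (Submodule.span_mono (Set.subset_inter (hST.trans (hTU.trans hUB))
      (hS.trans Set.inter_subset_right)) (hSspan ⟨hpP, hpQ⟩))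
    (Submodule.span_mono (Set.inter_subset_inter_left _ hUB) hq)

/-- A representation of the quiver `1 → 2 → 3` with peak `2` (i.e. `f` injective and
`g` surjective) is a direct sum of thin representations: there are bases `B₁, B₂, B₃`
with `f` mapping `B₁` injectively into `B₂`, and `g` sending each element of `B₂`
either to `0` or to an element of `B₃`, injectively on those not sent to `0`, and
onto `B₃`. -/
theorem A3_peak_inj_surj_direct_sum_of_thin
    (K V₁ V₂ V₃ : Type*) [Field K]
    [AddCommGroup V₁] [Module K V₁] [AddCommGroup V₂] [Module K V₂]
    [AddCommGroup V₃] [Module K V₃]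
    (f : V₁ →ₗ[K] V₂) (g : V₂ →ₗ[K] V₃)
    (hf : Function.Injective f) (hg : Function.Surjective g) :
    ∃ (B₁ : Set V₁) (B₂ : Set V₂) (B₃ : Set V₃),
      LinearIndependent K ((↑) : B₁ → V₁) ∧ Submodule.span K B₁ = ⊤ ∧
      LinearIndependent K ((↑) : B₂ → V₂) ∧ Submodule.span K B₂ = ⊤ ∧
      LinearIndependent K ((↑) : B₃ → V₃) ∧ Submodule.span K B₃ = ⊤ ∧
      (f '' B₁ ⊆ B₂) ∧ Set.InjOn f B₁ ∧
      (∀ b ∈ B₂, g b = 0 ∨ g b ∈ B₃) ∧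
      Set.InjOn g {b ∈ B₂ | g b ≠ 0} ∧
      g '' {b ∈ B₂ | g b ≠ 0} = B₃ := by
  obtain ⟨B, hB, hBtop, hP, hQ⟩ := exists_linearIndepOn_adapted
    (LinearMap.range f) (LinearMap.ker g)
  have himage : f '' (f ⁻¹' B) = B ∩ LinearMap.range f := by
    rw [Set.image_preimage_eq_inter_range, LinearMap.coe_range]
  have hdisj : Disjoint (Submodule.span K {b ∈ B | g b ≠ 0}) (LinearMap.ker g) := by
    have hsub : Disjoint {b ∈ B | g b ≠ 0} (B ∩ LinearMap.ker g) :=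
      Set.disjoint_left.2 fun x hx hx' => hx.2 hx'.2
    have hunion := hB.mono (Set.union_subset (Set.sep_subset B fun b => g b ≠ 0)
      (Set.inter_subset_left (t := (LinearMap.ker g : Set V₂))))
    have hspan := ((linearIndepOn_union_iff hsub).1 hunion).2.2
    simp only [Set.image_id] at hspan
    exact hspan.mono_right hQ
  have hgli : LinearIndepOn K g {b ∈ B | g b ≠ 0} :=
    (hB.mono (Set.sep_subset _ _)).map (by simpa using hdisj)
  refine ⟨f ⁻¹' B, B, g '' {b ∈ B | g b ≠ 0}, ?_, ?_, hB, hBtop, hgli.id_image, ?_,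
    Set.image_preimage_subset f B, hf.injOn, fun b hb => ?_, hgli.injOn, rfl⟩
  · have hfli : LinearIndepOn K id (f '' (f ⁻¹' B)) := hB.mono (Set.image_preimage_subset f B)
    exact LinearIndependent.of_comp f ((linearIndepOn_iff_image hf.injOn).2 hfli)
  · apply Submodule.map_injective_of_injective hf
    rw [Submodule.map_span, himage, Submodule.map_top]
    exact le_antisymm (Submodule.span_le.2 Set.inter_subset_right) hP
  · rw [← top_le_iff, ← LinearMap.range_eq_top.2 hg, ← Submodule.map_top, ← hBtop,
      Submodule.map_span, Submodule.span_le]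
    rintro _ ⟨b, hb, rfl⟩
    by_cases h : g b = 0
    · rw [h]; exact zero_mem _
    · exact Submodule.subset_span ⟨b, ⟨hb, h⟩, rfl⟩
  · by_cases h : g b = 0
    · exact Or.inl h
    · exact Or.inr ⟨b, ⟨hb, h⟩, rfl⟩
end

section
/- Let K be a field and let f : V₂ → V₁ and g : V₂ → V₃ be two surjective K-linear maps between K-vector spaces (a representation of the quiver A₃ with orientation 1←2→3 in which the middle vertex is a peak). Then there exist bases B₁ of V₁, B₂ of V₂, and B₃ of V₃ such that: every element of B₂ is sent by f either to 0 or to an element of B₁, with f injective on the elements of B₂ not sent to 0 and mapping them onto B₁; the same holds for g with respect to B₃; and moreover B₂ ∩ ker f ∩ ker g is a basis of ker f ∩ ker g. In particular the representation (V₁, V₂, V₃; f, g) is a direct sum of thin representations. -/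
open Submodule in
/-- Any two subspaces `N`, `M` of a vector space admit a common adapted basis. -/
theorem exists_linearIndepOn_id_adapted_to_pair {K V : Type*} [Field K] [AddCommGroup V]
    [Module K V] (N M : Submodule K V) :
    ∃ B : Set V, LinearIndepOn K id B ∧ span K B = ⊤ ∧
      N ≤ span K (B ∩ N) ∧ M ≤ span K (B ∩ M) ∧ N ⊓ M ≤ span K (B ∩ N ∩ M) := by
  obtain ⟨S, hSNM, -, hspanS, hS⟩ := exists_linearIndepOn_id_extension
    (linearIndepOn_empty K (id : V → V)) (Set.empty_subset ((N ⊓ M : Submodule K V) : Set V))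
  have hSN : S ⊆ N := fun x hx => (hSNM hx).1
  have hSM : S ⊆ M := fun x hx => (hSNM hx).2
  obtain ⟨S₁, hS₁N, hSS₁, hspanS₁, hS₁⟩ := exists_linearIndepOn_id_extension hS hSN
  obtain ⟨S₂, hS₂M, hSS₂, hspanS₂, hS₂⟩ := exists_linearIndepOn_id_extension hS hSM
  have hdiff : Disjoint (span K S) (span K (S₂ \ S)) := by
    rw [← Set.union_sdiff_cancel hSS₂, linearIndepOn_id_union_iff Set.disjoint_sdiff_right] at hS₂
    exact hS₂.2.2
  have hdisj : Disjoint (span K S₁) (span K (S₂ \ S)) := by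
    rw [disjoint_def] at hdiff ⊢
    intro x hx₁ hx₂
    have hxN : x ∈ N := span_le.2 hS₁N hx₁
    have hxM : x ∈ M := span_le.2 (Set.sdiff_subset.trans hS₂M) hx₂
    exact hdiff x (hspanS ⟨hxN, hxM⟩) hx₂
  obtain ⟨B, -, hSB, hspanB, hB⟩ := exists_linearIndepOn_id_extension
    (hS₁.id_union (hS₂.mono Set.sdiff_subset) hdisj) (Set.subset_univ _)
  have hS₁B : S₁ ⊆ B := Set.subset_union_left.trans hSB
  have hS₂B : S₂ ⊆ B := by
    intro x hx
    by_cases hxS : x ∈ S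
    · exact hS₁B (hSS₁ hxS)
    · exact hSB (Or.inr ⟨hx, hxS⟩)
  refine ⟨B, hB, eq_top_iff.2 fun x _ => hspanB (Set.mem_univ x), ?_, ?_, ?_⟩
  · exact le_trans hspanS₁ (span_mono fun x hx => ⟨hS₁B hx, hS₁N hx⟩)
  · exact le_trans hspanS₂ (span_mono fun x hx => ⟨hS₂B hx, hS₂M hx⟩)
  · exact le_trans hspanS (span_mono fun x hx => ⟨⟨hS₁B (hSS₁ hx), hSN hx⟩, hSM hx⟩)

open Submodule in
/-- If a basis `B` contains a basis of `ker f`, then a surjective `f` maps the rest of `B`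
bijectively onto a basis of the target. -/
theorem LinearIndepOn.image_basis_of_ker_le_span {K V W : Type*} [Field K] [AddCommGroup V]
    [Module K V] [AddCommGroup W] [Module K W] {f : V →ₗ[K] W} (hf : Function.Surjective f)
    {B : Set V} (hB : LinearIndepOn K id B) (hspan : span K B = ⊤)
    (hker : LinearMap.ker f ≤ span K (B ∩ LinearMap.ker f)) :
    LinearIndepOn K id (f '' {b ∈ B | f b ≠ 0}) ∧ span K (f '' {b ∈ B | f b ≠ 0}) = ⊤ ∧
      Set.InjOn f {b ∈ B | f b ≠ 0} := by
  have hunion : B = {b ∈ B | f b ≠ 0} ∪ (B ∩ LinearMap.ker f) := by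
    ext x
    by_cases hx : f x = 0 <;> simp [hx]
  have hdisj : Disjoint {b ∈ B | f b ≠ 0} (B ∩ LinearMap.ker f) :=
    Set.disjoint_left.2 fun x hx hx' => hx.2 hx'.2
  have hindep := hB
  rw [hunion, linearIndepOn_id_union_iff hdisj] at hindep
  have hdisj_ker : Disjoint (span K {b ∈ B | f b ≠ 0}) (LinearMap.ker f) :=
    hindep.2.2.mono_right hker
  refine ⟨hindep.1.image hdisj_ker, eq_top_iff.2 ?_,
    LinearMap.injOn_of_disjoint_ker subset_span hdisj_ker⟩
  have hmap : (span K B).map f = ⊤ := by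
    rw [hspan, Submodule.map_top, LinearMap.range_eq_top.2 hf]
  rw [← hmap, map_span, span_le]
  rintro _ ⟨b, hb, rfl⟩
  by_cases hfb : f b = 0
  · rw [hfb]
    exact zero_mem _
  · exact subset_span ⟨b, ⟨hb, hfb⟩, rfl⟩

/-- A representation of the quiver `1 ← 2 → 3` with peak `2` (i.e. `f, g` surjective)
is a direct sum of thin representations: there is a basis `B₂` of `V₂` together with
bases `B₁, B₃` such that `f` sends each element of `B₂` either to `0` or to an element
of `B₁`, injectively on those not sent to `0` and onto `B₁`; likewise for `g` and `B₃`;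
and `B₂ ∩ ker f ∩ ker g` is a basis of `ker f ∩ ker g`. -/
theorem A3_peak_surj_surj_direct_sum_of_thin
    (K V₁ V₂ V₃ : Type*) [Field K]
    [AddCommGroup V₁] [Module K V₁] [AddCommGroup V₂] [Module K V₂]
    [AddCommGroup V₃] [Module K V₃]
    (f : V₂ →ₗ[K] V₁) (g : V₂ →ₗ[K] V₃)
    (hf : Function.Surjective f) (hg : Function.Surjective g) :
    ∃ (B₁ : Set V₁) (B₂ : Set V₂) (B₃ : Set V₃),
      LinearIndependent K ((↑) : B₁ → V₁) ∧ Submodule.span K B₁ = ⊤ ∧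
      LinearIndependent K ((↑) : B₂ → V₂) ∧ Submodule.span K B₂ = ⊤ ∧
      LinearIndependent K ((↑) : B₃ → V₃) ∧ Submodule.span K B₃ = ⊤ ∧
      (∀ b ∈ B₂, f b = 0 ∨ f b ∈ B₁) ∧
      Set.InjOn f {b ∈ B₂ | f b ≠ 0} ∧ f '' {b ∈ B₂ | f b ≠ 0} = B₁ ∧
      (∀ b ∈ B₂, g b = 0 ∨ g b ∈ B₃) ∧
      Set.InjOn g {b ∈ B₂ | g b ≠ 0} ∧ g '' {b ∈ B₂ | g b ≠ 0} = B₃ ∧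
      Submodule.span K (B₂ ∩ (LinearMap.ker f : Set V₂) ∩ (LinearMap.ker g : Set V₂))
        = LinearMap.ker f ⊓ LinearMap.ker g := by
  obtain ⟨B, hB, hspan, hkf, hkg, hkfg⟩ :=
    exists_linearIndepOn_id_adapted_to_pair (LinearMap.ker f) (LinearMap.ker g)
  obtain ⟨hf_indep, hf_span, hf_inj⟩ := hB.image_basis_of_ker_le_span hf hspan hkf
  obtain ⟨hg_indep, hg_span, hg_inj⟩ := hB.image_basis_of_ker_le_span hg hspan hkg
  refine ⟨f '' {b ∈ B | f b ≠ 0}, B, g '' {b ∈ B | g b ≠ 0}, hf_indep, hf_span, hB, hspan,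
    hg_indep, hg_span, fun b hb => or_iff_not_imp_left.2 fun h => ⟨b, ⟨hb, h⟩, rfl⟩, hf_inj, rfl,
    fun b hb => or_iff_not_imp_left.2 fun h => ⟨b, ⟨hb, h⟩, rfl⟩, hg_inj, rfl,
    le_antisymm (Submodule.span_le.2 fun x hx => ⟨hx.1.2, hx.2⟩) hkfg⟩
end
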